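/- Let N ≥ 3. As ε → 0⁺, ∫_{ℝ^N_+} K(x) Ũ_ε(x)^{2*} dx = K₂ - β_N ε² + o(ε²), where β_N := (k_N^{2*} / (2(N-2))) ∫_{ℝ^N_+} |y|² / (1 + |y'|² + (y_N + x_N⁰)²)^{N} dy. -/

import Mathlib

open MeasureTheory Real Topology Filter

noncomputable section

/-- `ℝ^N` as Euclidean space. -/
abbrev Euc (N : ℕ) := EuclideanSpace ℝ (Fin N)

/-- Gaussian-type weight `K(x) = exp(|x|²/4)`. -/
noncomputable def Kw {N : ℕ} (x : Euc N) : ℝ := Real.exp (‖x‖ ^ 2 / 4)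

/-- critical Sobolev exponent `2* = 2N/(N-2)` -/
noncomputable def twoStar (N : ℕ) : ℝ := 2 * (N : ℝ) / ((N : ℝ) - 2)

/-- critical trace exponent `2_* = 2(N-1)/(N-2)` -/
noncomputable def twoStarL (N : ℕ) : ℝ := 2 * ((N : ℝ) - 1) / ((N : ℝ) - 2)

/-- `i`-th partial derivative of `u` at `x` -/
noncomputable def pd {N : ℕ} (u : Euc N → ℝ) (i : Fin N) (x : Euc N) : ℝ :=
  fderiv ℝ u x (EuclideanSpace.single i 1)

/-- `|∇u(x)|²` -/
noncomputable def gradSq {N : ℕ} (u : Euc N → ℝ) (x : Euc N) : ℝ :=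
  ∑ i, (pd u i x) ^ 2

/-- `x · ∇u(x)` -/
noncomputable def radial {N : ℕ} (u : Euc N → ℝ) (x : Euc N) : ℝ :=
  ∑ i, x i * pd u i x

/-- Laplacian `Δu(x)` -/
noncomputable def lap {N : ℕ} (u : Euc N → ℝ) (x : Euc N) : ℝ :=
  ∑ i, pd (pd u i) i x

/-- index of the vertical coordinate `x_N` -/
def lastIdx (N : ℕ) (h : 0 < N) : Fin N := ⟨N - 1, by omega⟩

/-- open upper half-space `ℝ^N_+` -/
def upperHS (N : ℕ) (h : 0 < N) : Set (Euc N) := {x | 0 < x (lastIdx N h)}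

/-- closed upper half-space -/
def upperHSc (N : ℕ) (h : 0 < N) : Set (Euc N) := {x | 0 ≤ x (lastIdx N h)}

/-- boundary hyperplane `∂ℝ^N_+` -/
def bdryHS (N : ℕ) (h : 0 < N) : Set (Euc N) := {x | x (lastIdx N h) = 0}

/-- vertical derivative `∂u/∂x_N`, taken within the closed half-space -/
noncomputable def pdN (N : ℕ) (h : 0 < N) (u : Euc N → ℝ) (x : Euc N) : ℝ :=
  fderivWithin ℝ u (upperHSc N h) x (EuclideanSpace.single (lastIdx N h) 1)

/-- embedding of `ℝ^{N-1}` as the boundary of the half-space, `y ↦ (y, 0)` -/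
noncomputable def emb (N : ℕ) (y : Euc (N - 1)) : Euc N :=
  (EuclideanSpace.equiv (Fin N) ℝ).symm
    (fun i => if hi : (i : ℕ) < N - 1 then y ⟨(i : ℕ), hi⟩ else 0)

/-- finite weighted energy, i.e. membership in the space `X` -/
def FiniteEnergy (N : ℕ) (h : 0 < N) (u : Euc N → ℝ) : Prop :=
  IntegrableOn (fun x => Kw x * (gradSq u x + (u x) ^ 2)) (upperHS N h)

/-- classical solution of problem (1.1) -/
structure IsClassicalSolution (N : ℕ) (h : 0 < N) (lam mu p : ℝ) (u : Euc N → ℝ) : Prop where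
  smooth2 : ContDiffOn ℝ 2 u (upperHS N h)
  smooth1 : ContDiffOn ℝ 1 u (upperHSc N h)
  pde : ∀ x ∈ upperHS N h,
    -lap u x - (1 / 2) * radial u x
      = lam * |u x| ^ (twoStar N - 2) * u x + mu * |u x| ^ (p - 2) * u x
  bc : ∀ x ∈ bdryHS N h,
    -pdN N h u x = Real.sqrt lam * |u x| ^ (twoStarL N - 2) * u x

/-- `x_N⁰ = √(N/(N-2))` -/
noncomputable def xN0 (N : ℕ) : ℝ := Real.sqrt ((N : ℝ) / ((N : ℝ) - 2))

/-- `k_N = (N(N-2))^{(N-2)/4}` -/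
noncomputable def kN (N : ℕ) : ℝ := ((N : ℝ) * ((N : ℝ) - 2)) ^ (((N : ℝ) - 2) / 4)

/-- `|x'|²`, squared norm of the horizontal part -/
noncomputable def horizSq {N : ℕ} (h : 0 < N) (x : Euc N) : ℝ :=
  ∑ i ∈ Finset.univ.erase (lastIdx N h), (x i) ^ 2

/-- the family `φ_{ε,τ}` -/
noncomputable def bubbleT (N : ℕ) (h : 0 < N) (ε τ : ℝ) (x : Euc N) : ℝ :=
  (ε * Real.sqrt ((N : ℝ) * ((N : ℝ) - 2)) /
      (ε ^ 2 + horizSq h x + (x (lastIdx N h) + ε * τ * xN0 N) ^ 2)) ^ (((N : ℝ) - 2) / 2)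

/-- the boundary bubble `U_ε = φ_{ε,1}` -/
noncomputable def Ubub (N : ℕ) (h : 0 < N) (ε : ℝ) (x : Euc N) : ℝ := bubbleT N h ε 1 x

/-- `K₁ = ∫_{ℝ^N_+} |∇U_ε|²` (an `ε`-independent constant, computed at `ε = 1`) -/
noncomputable def Kone (N : ℕ) (h : 0 < N) : ℝ :=
  ∫ x in upperHS N h, gradSq (Ubub N h 1) x

/-- `K₂ = ∫_{ℝ^N_+} U_ε^{2*}` -/
noncomputable def Ktwo (N : ℕ) (h : 0 < N) : ℝ :=
  ∫ x in upperHS N h, (Ubub N h 1 x) ^ twoStar N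

/-- `K₃ = ∫_{ℝ^{N-1}} U_ε(x',0)^{2_*}` -/
noncomputable def Kthree (N : ℕ) (h : 0 < N) : ℝ :=
  ∫ y : Euc (N - 1), (Ubub N h 1 (emb N y)) ^ twoStarL N

/-- cut-off function: `φ ∈ C_c^∞(ℝ^N,[0,1])`, `φ ≡ 1` on `B₁(0)`, `φ ≡ 0` outside `B₂(0)` -/
structure IsCutoff (N : ℕ) (φ : Euc N → ℝ) : Prop where
  smooth : ContDiff ℝ (⊤ : ℕ∞) φ
  mem01 : ∀ x, φ x ∈ Set.Icc (0 : ℝ) 1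
  eq_one : ∀ x ∈ Metric.closedBall (0 : Euc N) 1, φ x = 1
  eq_zero : ∀ x ∉ Metric.ball (0 : Euc N) 2, φ x = 0

/-- truncated weighted bubble `Ũ_ε = K^{-1/2} φ U_ε` -/
noncomputable def Ut (N : ℕ) (h : 0 < N) (φ : Euc N → ℝ) (ε : ℝ) (x : Euc N) : ℝ :=
  (Kw x) ^ (-(1 : ℝ) / 2) * φ x * Ubub N h ε x

/-- smooth compactly supported test functions on the closed half-space -/
structure IsTestFun (N : ℕ) (h : 0 < N) (u : Euc N → ℝ) : Prop where
  smooth : ContDiff ℝ (⊤ : ℕ∞) u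
  cpt : HasCompactSupport u
  supp : tsupport u ⊆ upperHSc N h

/-- the norm of the space `X`: `‖u‖ = (∫ K |∇u|²)^{1/2}` -/
noncomputable def Xnorm (N : ℕ) (h : 0 < N) (u : Euc N → ℝ) : ℝ :=
  Real.sqrt (∫ x in upperHS N h, Kw x * gradSq u x)


/-- the denominator at scale one -/
def DD (N : ℕ) (h : 0 < N) (y : Euc N) : ℝ :=
  1 + horizSq h y + (y (lastIdx N h) + xN0 N) ^ 2

/-- the effective weight after the computation of powers -/
def gg (N : ℕ) (φ : Euc N → ℝ) (x : Euc N) : ℝ :=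
  Real.exp (-(‖x‖ ^ 2 / (2 * ((N : ℝ) - 2)))) * φ x ^ twoStar N

lemma norm_sq_split {N : ℕ} (h : 0 < N) (y : Euc N) :
    ‖y‖ ^ 2 = horizSq h y + y (lastIdx N h) ^ 2 := by
  rw [EuclideanSpace.norm_sq_eq, horizSq, Finset.sum_erase_add _ _ (Finset.mem_univ _)]
  simp

lemma xN0_nonneg (N : ℕ) : 0 ≤ xN0 N := Real.sqrt_nonneg _

lemma DD_ge {N : ℕ} (h : 0 < N) (y : Euc N) (hy : y ∈ upperHS N h) :
    1 + ‖y‖ ^ 2 ≤ DD N h y := by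
  have hy' : 0 < y (lastIdx N h) := hy
  have := xN0_nonneg N
  rw [norm_sq_split h, DD]
  nlinarith [mul_nonneg hy'.le this]

lemma horizSq_nonneg {N : ℕ} (h : 0 < N) (y : Euc N) : 0 ≤ horizSq h y :=
  Finset.sum_nonneg fun _ _ => sq_nonneg _

lemma DD_pos {N : ℕ} (h : 0 < N) (y : Euc N) : 0 < DD N h y := by
  have := horizSq_nonneg h y
  unfold DD
  positivity

lemma DD_cont {N : ℕ} (h : 0 < N) : Continuous (DD N h) := by
  unfold DD horizSq
  fun_prop

lemma meas_HS {N : ℕ} (h : 0 < N) : MeasurableSet (upperHS N h) := by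
  unfold upperHS
  exact measurableSet_lt measurable_const (by fun_prop)

open scoped Pointwise in
lemma smul_HS {N : ℕ} (h : 0 < N) {ε : ℝ} (hε : 0 < ε) :
    (ε • upperHS N h : Set (Euc N)) = upperHS N h := by
  ext x
  rw [Set.mem_smul_set_iff_inv_smul_mem₀ hε.ne']
  simp only [upperHS, Set.mem_setOf_eq, PiLp.smul_apply, smul_eq_mul]
  exact mul_pos_iff_of_pos_left (inv_pos.mpr hε)

lemma base_integrable {N : ℕ} (hN : 3 ≤ N) :
    Integrable (fun y : Euc N => (1 + ‖y‖ ^ 2) / (1 + ‖y‖ ^ 2) ^ N) := by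
  have h3 : (3 : ℝ) ≤ N := by exact_mod_cast hN
  have := integrable_rpow_neg_one_add_norm_sq (E := Euc N) (μ := volume) (r := 2 * (N : ℝ) - 2)
    (by simp; linarith)
  refine this.congr (Eventually.of_forall fun y => ?_)
  have hp : 0 < 1 + ‖y‖ ^ 2 := by positivity
  show (1 + ‖y‖ ^ 2) ^ (-(2 * (N : ℝ) - 2) / 2) = (1 + ‖y‖ ^ 2) / (1 + ‖y‖ ^ 2) ^ N
  rw [show -(2 * (N : ℝ) - 2) / 2 = 1 - N by ring, Real.rpow_sub hp, Real.rpow_one,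
    Real.rpow_natCast]

lemma div_bound {N : ℕ} (h : 0 < N) (y : Euc N) (hy : y ∈ upperHS N h) {t M : ℝ}
    (ht : |t| ≤ M * (1 + ‖y‖ ^ 2)) :
    ‖t / DD N h y ^ N‖ ≤ M * ((1 + ‖y‖ ^ 2) / (1 + ‖y‖ ^ 2) ^ N) := by
  have hp : 0 < 1 + ‖y‖ ^ 2 := by positivity
  have hD := DD_ge h y hy
  have hDp := DD_pos h y
  rw [norm_div, Real.norm_eq_abs, Real.norm_of_nonneg (by positivity), ← mul_div_assoc]
  have h1 : 0 ≤ M * (1 + ‖y‖ ^ 2) := (abs_nonneg t).trans ht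
  gcongr

lemma int_lemma {N : ℕ} (hN : 3 ≤ N) (h : 0 < N) (f : Euc N → ℝ) (M : ℝ) (hf : Continuous f)
    (hM : ∀ y, |f y| ≤ M * (1 + ‖y‖ ^ 2)) :
    IntegrableOn (fun y => f y / DD N h y ^ N) (upperHS N h) := by
  refine Integrable.mono' (((base_integrable hN).const_mul M).integrableOn) ?_ ?_
  · refine Continuous.aestronglyMeasurable ?_
    exact hf.div ((DD_cont h).pow N) fun y => (pow_pos (DD_pos h y) N).ne'
  · filter_upwards [ae_restrict_mem (meas_HS h)] with y hy
    exact div_bound h y hy (hM y)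

lemma twoStar_nonneg {N : ℕ} (hN : 3 ≤ N) : 0 ≤ twoStar N := by
  have h3 : (3 : ℝ) ≤ N := by exact_mod_cast hN
  unfold twoStar
  exact div_nonneg (by linarith) (by linarith)

lemma gg_cont {N : ℕ} (hN : 3 ≤ N) {φ : Euc N → ℝ} (hφ : IsCutoff N φ) : Continuous (gg N φ) := by
  unfold gg
  refine Continuous.mul (by fun_prop) ?_
  exact hφ.smooth.continuous.rpow_const fun x => Or.inr (twoStar_nonneg hN)

lemma gg_mem {N : ℕ} (hN : 3 ≤ N) {φ : Euc N → ℝ} (hφ : IsCutoff N φ) (x : Euc N) :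
    0 ≤ gg N φ x ∧ gg N φ x ≤ 1 := by
  have h3 : (3 : ℝ) ≤ N := by exact_mod_cast hN
  obtain ⟨h0, h1⟩ := hφ.mem01 x
  have ha : 0 ≤ φ x ^ twoStar N := Real.rpow_nonneg h0 _
  have hb : φ x ^ twoStar N ≤ 1 := Real.rpow_le_one h0 h1 (twoStar_nonneg hN)
  have hc : Real.exp (-(‖x‖ ^ 2 / (2 * ((N : ℝ) - 2)))) ≤ 1 := by
    rw [Real.exp_le_one_iff, neg_nonpos]
    exact div_nonneg (by positivity) (by linarith)
  exact ⟨mul_nonneg (Real.exp_pos _).le ha, mul_le_one₀ hc ha hb⟩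

lemma gg_near {N : ℕ} {φ : Euc N → ℝ} (hφ : IsCutoff N φ) (x : Euc N) (hx : ‖x‖ ≤ 1) :
    gg N φ x = Real.exp (-(‖x‖ ^ 2 / (2 * ((N : ℝ) - 2)))) := by
  rw [gg, hφ.eq_one x (by simpa using hx), Real.one_rpow, mul_one]

lemma gg_sub {N : ℕ} (hN : 3 ≤ N) {φ : Euc N → ℝ} (hφ : IsCutoff N φ) (x : Euc N) :
    |gg N φ x - 1| ≤ ‖x‖ ^ 2 := by
  have h3 : (3 : ℝ) ≤ N := by exact_mod_cast hN
  obtain ⟨h0, h1⟩ := gg_mem hN hφ x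
  rw [abs_of_nonpos (by linarith)]
  by_cases hx : ‖x‖ ≤ 1
  · rw [gg_near hφ x hx]
    have := Real.add_one_le_exp (-(‖x‖ ^ 2 / (2 * ((N : ℝ) - 2))))
    have h2 : ‖x‖ ^ 2 / (2 * ((N : ℝ) - 2)) ≤ ‖x‖ ^ 2 :=
      div_le_self (by positivity) (by linarith)
    linarith
  · push Not at hx
    nlinarith

lemma bub_pow {N : ℕ} (hN : 3 ≤ N) (h : 0 < N) {ε : ℝ} (hε : 0 < ε) (y : Euc N) :
    Ubub N h ε (ε • y) ^ twoStar N = (ε ^ N)⁻¹ * (kN N ^ twoStar N / DD N h y ^ N) := by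
  have h3 : (3 : ℝ) ≤ N := by exact_mod_cast hN
  have hDp := DD_pos h y
  have hs : (0 : ℝ) ≤ N * (N - 2) := mul_nonneg (by linarith) (by linarith)
  have hk : kN N ^ twoStar N = Real.sqrt ((N : ℝ) * ((N : ℝ) - 2)) ^ N := by
    rw [kN, ← Real.rpow_mul hs, Real.sqrt_eq_rpow, ← Real.rpow_natCast, ← Real.rpow_mul hs]
    congr 1
    unfold twoStar
    have : (N : ℝ) - 2 ≠ 0 := by linarith
    field_simp
    ring
  have hden : ε ^ 2 + horizSq h (ε • y) + ((ε • y) (lastIdx N h) + ε * 1 * xN0 N) ^ 2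
      = ε ^ 2 * DD N h y := by
    simp only [horizSq, DD, PiLp.smul_apply, smul_eq_mul, mul_pow, ← Finset.mul_sum]
    ring
  have hexp : ((N : ℝ) - 2) / 2 * twoStar N = N := by
    unfold twoStar
    have : (N : ℝ) - 2 ≠ 0 := by linarith
    field_simp
  rw [Ubub, bubbleT, hden, ← Real.rpow_mul (by positivity), hexp, Real.rpow_natCast, hk,
    show ε * Real.sqrt ((N : ℝ) * ((N : ℝ) - 2)) / (ε ^ 2 * DD N h y)
      = ε⁻¹ * (Real.sqrt ((N : ℝ) * ((N : ℝ) - 2)) / DD N h y) by field_simp,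
    mul_pow, div_pow, inv_pow]

lemma Ubub_nonneg {N : ℕ} (h : 0 < N) {ε : ℝ} (hε : 0 < ε) (y : Euc N) :
    0 ≤ Ubub N h ε y := by
  have := horizSq_nonneg h y
  unfold Ubub bubbleT
  positivity

lemma integrand_eq {N : ℕ} (hN : 3 ≤ N) (h : 0 < N) {φ : Euc N → ℝ} (hφ : IsCutoff N φ)
    {ε : ℝ} (hε : 0 < ε) (y : Euc N) :
    Kw (ε • y) * Ut N h φ ε (ε • y) ^ twoStar N =
      (ε ^ N)⁻¹ * (kN N ^ twoStar N * (gg N φ (ε • y) / DD N h y ^ N)) := by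
  have h3 : (3 : ℝ) ≤ N := by exact_mod_cast hN
  have h0 := (hφ.mem01 (ε • y)).1
  have hU := Ubub_nonneg h hε (ε • y)
  have hK : 0 < Kw (ε • y) := Real.exp_pos _
  have hKK : Kw (ε • y) * (Kw (ε • y) ^ (-(1 : ℝ) / 2)) ^ twoStar N
      = Real.exp (-(‖ε • y‖ ^ 2 / (2 * ((N : ℝ) - 2)))) := by
    rw [← Real.rpow_mul hK.le, Kw, ← Real.exp_mul, ← Real.exp_add]
    congr 1
    unfold twoStar
    have : (N : ℝ) - 2 ≠ 0 := by linarith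
    field_simp
    ring
  rw [Ut, Real.mul_rpow (by positivity) hU, Real.mul_rpow (by positivity) h0, bub_pow hN h hε,
    gg, ← hKK]
  ring

lemma limit_lemma {N : ℕ} (hN : 3 ≤ N) (h : 0 < N) {φ : Euc N → ℝ} (hφ : IsCutoff N φ) :
    Tendsto (fun ε : ℝ => ∫ y in upperHS N h,
      ((gg N φ (ε • y) - 1) / ε ^ 2 + ‖y‖ ^ 2 / (2 * ((N : ℝ) - 2))) / DD N h y ^ N)
      (𝓝[>] (0 : ℝ)) (𝓝 0) := by
  have h3 : (3 : ℝ) ≤ N := by exact_mod_cast hN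
  have key := tendsto_integral_filter_of_dominated_convergence
    (μ := volume.restrict (upperHS N h)) (l := 𝓝[>] (0 : ℝ))
    (F := fun (ε : ℝ) (y : Euc N) =>
      ((gg N φ (ε • y) - 1) / ε ^ 2 + ‖y‖ ^ 2 / (2 * ((N : ℝ) - 2))) / DD N h y ^ N)
    (f := fun _ => (0 : ℝ))
    (fun y => 2 * ((1 + ‖y‖ ^ 2) / (1 + ‖y‖ ^ 2) ^ N)) ?_ ?_ ?_ ?_
  · simpa using key
  · refine Eventually.of_forall fun ε => Continuous.aestronglyMeasurable ?_
    refine Continuous.div ?_ ((DD_cont h).pow N) fun y => (pow_pos (DD_pos h y) N).ne'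
    have := gg_cont hN hφ
    fun_prop
  · filter_upwards [self_mem_nhdsWithin] with ε (hε : 0 < ε)
    filter_upwards [ae_restrict_mem (meas_HS h)] with y hy
    refine div_bound h y hy ?_
    have h1 : |(gg N φ (ε • y) - 1) / ε ^ 2| ≤ ‖y‖ ^ 2 := by
      rw [abs_div, abs_of_pos (by positivity : 0 < ε ^ 2), div_le_iff₀ (by positivity)]
      have := gg_sub hN hφ (ε • y)
      rwa [norm_smul, mul_pow, Real.norm_of_nonneg hε.le, mul_comm] at this
    have h2 : |‖y‖ ^ 2 / (2 * ((N : ℝ) - 2))| ≤ ‖y‖ ^ 2 := by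
      rw [abs_of_nonneg (div_nonneg (by positivity) (by linarith))]
      exact div_le_self (by positivity) (by linarith)
    have := abs_add_le ((gg N φ (ε • y) - 1) / ε ^ 2) (‖y‖ ^ 2 / (2 * ((N : ℝ) - 2)))
    linarith
  · exact ((base_integrable hN).const_mul 2).integrableOn
  · refine Eventually.of_forall fun y => ?_
    suffices hs : Tendsto (fun ε : ℝ => (gg N φ (ε • y) - 1) / ε ^ 2
        + ‖y‖ ^ 2 / (2 * ((N : ℝ) - 2))) (𝓝[>] (0 : ℝ)) (𝓝 0) by
      simpa using hs.div_const (DD N h y ^ N)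
    set b := ‖y‖ ^ 2 / (2 * ((N : ℝ) - 2)) with hb
    have hb0 : 0 ≤ b := div_nonneg (by positivity) (by linarith)
    have t1 : Tendsto (fun ε : ℝ => ‖ε • y‖) (𝓝[>] (0 : ℝ)) (𝓝 0) := by
      have : Continuous fun ε : ℝ => ‖ε • y‖ := by fun_prop
      simpa using (this.tendsto 0).mono_left nhdsWithin_le_nhds
    have t2 : Tendsto (fun ε : ℝ => b * ε ^ 2) (𝓝[>] (0 : ℝ)) (𝓝 0) := by
      have : Continuous fun ε : ℝ => b * ε ^ 2 := by fun_prop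
      simpa using (this.tendsto 0).mono_left nhdsWithin_le_nhds
    have t3 : Tendsto (fun ε : ℝ => b ^ 2 * ε ^ 2) (𝓝[>] (0 : ℝ)) (𝓝 0) := by
      have : Continuous fun ε : ℝ => b ^ 2 * ε ^ 2 := by fun_prop
      simpa using (this.tendsto 0).mono_left nhdsWithin_le_nhds
    refine squeeze_zero_norm' ?_ t3
    filter_upwards [self_mem_nhdsWithin, t1.eventually_le_const one_pos,
      t2.eventually_le_const one_pos] with ε (hε : 0 < ε) e1 e2
    have hx : ‖ε • y‖ ^ 2 / (2 * ((N : ℝ) - 2)) = b * ε ^ 2 := by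
      rw [norm_smul, mul_pow, Real.norm_of_nonneg hε.le, hb]
      ring
    rw [gg_near hφ _ e1, hx, Real.norm_eq_abs]
    have e3 : |-(b * ε ^ 2)| ≤ 1 := by
      rwa [abs_neg, abs_of_nonneg (by positivity)]
    have e4 := Real.abs_exp_sub_one_sub_id_le e3
    have e5 : (Real.exp (-(b * ε ^ 2)) - 1) / ε ^ 2 + b
        = (Real.exp (-(b * ε ^ 2)) - 1 - -(b * ε ^ 2)) / ε ^ 2 := by
      field_simp
      ring
    rw [e5, abs_div, abs_of_pos (by positivity : 0 < ε ^ 2), div_le_iff₀ (by positivity)]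
    calc _ ≤ _ := e4
      _ = _ := by ring

/-- Lemma 3.3: `∫ K Ũ_ε^{2*} = K₂ - β_N ε² + o(ε²)` as `ε → 0⁺`. -/
theorem statement15 (N : ℕ) (hN : 3 ≤ N) (φ : Euc N → ℝ) (hφ : IsCutoff N φ) :
    Tendsto (fun ε : ℝ =>
        ((∫ x in upperHS N (by omega : 0 < N), Kw x * (Ut N (by omega) φ ε x) ^ twoStar N)
            - Ktwo N (by omega)
            + ((kN N ^ twoStar N / (2 * ((N : ℝ) - 2))) *
                ∫ y in upperHS N (by omega : 0 < N),
                  ‖y‖ ^ 2 /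
                    (1 + horizSq (by omega) y
                      + (y (lastIdx N (by omega)) + xN0 N) ^ 2) ^ N) * ε ^ 2)
          / ε ^ 2)
      (𝓝[>] (0 : ℝ)) (𝓝 0) := by
  have h : 0 < N := by omega
  have h3 : (3 : ℝ) ≤ N := by exact_mod_cast hN
  have key := (limit_lemma hN h hφ).const_mul (kN N ^ twoStar N)
  rw [mul_zero] at key
  refine key.congr' ?_
  filter_upwards [self_mem_nhdsWithin] with ε (hε : 0 < ε)
  have I1 : (∫ x in upperHS N h, Kw x * (Ut N h φ ε x) ^ twoStar N)
      = kN N ^ twoStar N * ∫ y in upperHS N h, gg N φ (ε • y) / DD N h y ^ N := by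
    have := Measure.setIntegral_comp_smul_of_pos (volume : Measure (Euc N))
      (fun x => Kw x * (Ut N h φ ε x) ^ twoStar N) (upperHS N h) hε
    rw [smul_HS h hε] at this
    simp only [integrand_eq hN h hφ hε, integral_const_mul, finrank_euclideanSpace_fin,
      smul_eq_mul] at this
    exact (mul_left_cancel₀ (inv_ne_zero (pow_ne_zero N hε.ne')) this).symm
  have I2 : Ktwo N h = kN N ^ twoStar N * ∫ y in upperHS N h, 1 / DD N h y ^ N := by
    rw [Ktwo, ← integral_const_mul]
    refine integral_congr_ae (Eventually.of_forall fun y => ?_)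
    have := bub_pow hN h one_pos y
    rw [one_smul] at this
    show Ubub N h 1 y ^ twoStar N = _
    rw [this]
    ring
  have J1 : IntegrableOn (fun y => gg N φ (ε • y) / DD N h y ^ N) (upperHS N h) := by
    refine int_lemma hN h (fun y => gg N φ (ε • y)) 1 ?_ fun y => ?_
    · have := gg_cont hN hφ
      fun_prop
    · have := gg_mem hN hφ (ε • y)
      show |gg N φ (ε • y)| ≤ _
      rw [abs_of_nonneg this.1]
      nlinarith [sq_nonneg ‖y‖]
  have J2 : IntegrableOn (fun y => 1 / DD N h y ^ N) (upperHS N h) :=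
    int_lemma hN h (fun y => 1) 1 continuous_const fun y => by
      rw [abs_one]
      nlinarith [sq_nonneg ‖y‖]
  have J3 : IntegrableOn (fun y => ‖y‖ ^ 2 / DD N h y ^ N) (upperHS N h) :=
    int_lemma hN h (fun y => ‖y‖ ^ 2) 1 (by fun_prop) fun y => by
      rw [abs_of_nonneg (sq_nonneg _)]
      linarith
  have I3 : (∫ y in upperHS N h,
      ((gg N φ (ε • y) - 1) / ε ^ 2 + ‖y‖ ^ 2 / (2 * ((N : ℝ) - 2))) / DD N h y ^ N)
      = (ε ^ 2)⁻¹ * ((∫ y in upperHS N h, gg N φ (ε • y) / DD N h y ^ N)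
          - ∫ y in upperHS N h, 1 / DD N h y ^ N)
        + (2 * ((N : ℝ) - 2))⁻¹ * ∫ y in upperHS N h, ‖y‖ ^ 2 / DD N h y ^ N := by
    have J4 : IntegrableOn (fun y => (ε ^ 2)⁻¹ *
        (gg N φ (ε • y) / DD N h y ^ N - 1 / DD N h y ^ N)) (upperHS N h) :=
      (J1.sub J2).const_mul _
    rw [← integral_sub J1 J2, ← integral_const_mul, ← integral_const_mul,
      ← integral_add J4 (J3.const_mul _)]
    refine integral_congr_ae (Eventually.of_forall fun y => ?_)
    show _ = (ε ^ 2)⁻¹ * (gg N φ (ε • y) / DD N h y ^ N - 1 / DD N h y ^ N)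
      + (2 * ((N : ℝ) - 2))⁻¹ * (‖y‖ ^ 2 / DD N h y ^ N)
    ring
  rw [I3, I1, I2]
  show _ = (_ - _ + kN N ^ twoStar N / (2 * ((N : ℝ) - 2)) *
    (∫ y in upperHS N h, ‖y‖ ^ 2 / DD N h y ^ N) * ε ^ 2) / ε ^ 2
  have : (N : ℝ) - 2 ≠ 0 := by linarith
  field_simp
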